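/- Negative moments of the number of order-2 branches (Proposition 2): for every fixed k ≥ 0, the expectation ⟨S_{2,n}^{−k}⟩ under P_n is asymptotically equivalent, as n → ∞, to (n/4)^{−k}. (Since S_{2,n}(τ) ≥ 1 for every τ ∈ Ω_n with n ≥ 2, the expectation is finite.) -/

import Mathlib

open MeasureTheory ProbabilityTheory Filter
open scoped NNReal Topology

/-- Binary trees: every internal node has exactly two children. -/
inductive BinTree : Type
  | leaf : BinTree
  | node : BinTree → BinTree → BinTree
  deriving DecidableEq

namespace BinTree

/-- The magnitude of a binary tree is its number of leaves. -/
def magnitude : BinTree → ℕ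
  | leaf => 1
  | node l r => magnitude l + magnitude r

/-- The Horton–Strahler order of (the root of) a binary tree:
leaves have order 1; a node whose two children have distinct orders has the max of the two;
a node whose two children have equal order `r` has order `r + 1`. -/
def ord : BinTree → ℕ
  | leaf => 1
  | node l r => if ord l = ord r then ord l + 1 else max (ord l) (ord r)

/-- `branches k τ` is `S_{k,n}(τ)`, the number of Horton–Strahler branches of order `k`
in `τ`, i.e. the number of maximal connected paths of nodes of order `k`.  It counts the
nodes of order `k` that head a branch: a new branch head of order `ord l + 1` is created
exactly at a node whose two children have equal order `ord l`, and every leaf heads an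
order-1 branch. -/
def branches (k : ℕ) : BinTree → ℕ
  | leaf => if k = 1 then 1 else 0
  | node l r => branches k l + branches k r +
      (if ord l = ord r ∧ ord l + 1 = k then 1 else 0)

end BinTree

/-- `treesOf n` is the finite set `Ω_n` of binary trees of magnitude `n`. -/
def treesOf : ℕ → Finset BinTree
  | 0 => ∅
  | 1 => {BinTree.leaf}
  | (n+2) => (Finset.range (n+1)).attach.biUnion fun k =>
      ((treesOf (k.1+1)) ×ˢ (treesOf (n+1-k.1))).image fun p => BinTree.node p.1 p.2
  decreasing_by
  · have := Finset.mem_range.mp k.2; omega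
  · omega

/-- Expectation `⟨f⟩` under the uniform probability measure `P_n` on `Ω_n` (the random model). -/
noncomputable def expect (n : ℕ) (f : BinTree → ℝ) : ℝ :=
  (∑ τ ∈ treesOf n, f τ) / (treesOf n).card

namespace BinTree

theorem one_le_ord (τ : BinTree) : 1 ≤ ord τ := by
  induction τ with
  | leaf => simp [ord]
  | node l r hl hr => simp only [ord]; split_ifs <;> omega

theorem ord_eq_one_iff (τ : BinTree) : ord τ = 1 ↔ τ = leaf := by
  cases τ with
  | leaf => simp [ord]
  | node l r =>
    have hl := one_le_ord l
    have hr := one_le_ord r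
    simp only [ord, reduceCtorEq, iff_false]
    split_ifs <;> omega

theorem branches_two_node (l r : BinTree) :
    branches 2 (node l r) =
      branches 2 l + branches 2 r + if l = leaf ∧ r = leaf then 1 else 0 := by
  have h : (ord l = ord r ∧ ord l + 1 = 2) ↔ (l = leaf ∧ r = leaf) := by
    rw [← ord_eq_one_iff, ← ord_eq_one_iff]; omega
  simp only [branches, h]

theorem branches_two_eq_zero_iff (τ : BinTree) : branches 2 τ = 0 ↔ τ = leaf := by
  induction τ with
  | leaf => simp [branches]
  | node l r hl hr =>
    rw [branches_two_node]
    simp only [Nat.add_eq_zero_iff, hl, hr, reduceCtorEq, iff_false]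
    rintro ⟨h, h'⟩
    simp [h] at h'

end BinTree

open BinTree
open Finset.HasAntidiagonal (antidiagonal)

theorem treesOf_succ_succ (n : ℕ) :
    treesOf (n + 2) = (Finset.range (n + 1)).biUnion fun k =>
      ((treesOf (k + 1)) ×ˢ (treesOf (n + 1 - k))).image fun p => node p.1 p.2 := by
  rw [treesOf]
  ext τ
  simp

theorem magnitude_of_mem_treesOf {n : ℕ} {τ : BinTree} (h : τ ∈ treesOf n) :
    magnitude τ = n := by
  induction τ generalizing n with
  | leaf =>
    match n with
    | 0 => simp [treesOf] at h
    | 1 => simp [magnitude]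
    | n + 2 => simp [treesOf_succ_succ] at h
  | node l r hl hr =>
    match n with
    | 0 => simp [treesOf] at h
    | 1 => simp [treesOf] at h
    | n + 2 =>
      simp only [treesOf_succ_succ, Finset.mem_biUnion, Finset.mem_range, Finset.mem_image,
        Finset.mem_product, Prod.exists, node.injEq] at h
      obtain ⟨k, hk, a, b, ⟨ha, hb⟩, rfl, rfl⟩ := h
      simp only [magnitude, hl ha, hr hb]
      omega

/-- Decomposition of a sum over trees of magnitude `n` at the root. -/
theorem sum_treesOf (n : ℕ) (f : BinTree → ℝ) :
    ∑ τ ∈ treesOf n, f τ = (if n = 1 then f leaf else 0) +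
      ∑ p ∈ antidiagonal n, ∑ l ∈ treesOf p.1, ∑ r ∈ treesOf p.2, f (node l r) := by
  match n with
  | 0 => simp [treesOf]
  | 1 => simp [treesOf, Finset.Nat.antidiagonal_succ]
  | n + 2 =>
    have h0 : treesOf 0 = ∅ := by rw [treesOf]
    rw [Finset.Nat.sum_antidiagonal_eq_sum_range_succ_mk, Finset.sum_range_succ',
      Finset.sum_range_succ, if_neg (by omega), treesOf_succ_succ, Finset.sum_biUnion]
    · simp only [h0, Finset.sum_empty, Nat.sub_self, Finset.sum_const_zero, add_zero, zero_add]
      refine Finset.sum_congr rfl fun k _ => ?_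
      rw [Finset.sum_image (by rintro ⟨a, b⟩ _ ⟨c, d⟩ _ h; simpa using h), Finset.sum_product]
      rw [show n + 2 - (k + 1) = n + 1 - k by omega]
    · intro i hi j hj hij
      refine Finset.disjoint_left.mpr ?_
      intro τ h1 h2
      simp only [Finset.mem_image, Finset.mem_product, Prod.exists] at h1 h2
      obtain ⟨a, b, ⟨ha, -⟩, rfl⟩ := h1
      obtain ⟨c, d, ⟨hc, -⟩, h⟩ := h2
      obtain ⟨rfl, rfl⟩ := (node.injEq ..).mp h
      have := magnitude_of_mem_treesOf ha
      have := magnitude_of_mem_treesOf hc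
      omega

theorem card_treesOf_succ (n : ℕ) : (treesOf (n + 1)).card = catalan n := by
  induction n using Nat.strong_induction_on with
  | _ n ih =>
    match n with
    | 0 => simp [treesOf]
    | n + 1 =>
      have h := sum_treesOf (n + 2) fun _ => 1
      simp only [Finset.sum_const, nsmul_eq_mul, mul_one] at h
      rw [Finset.Nat.sum_antidiagonal_eq_sum_range_succ_mk, Finset.sum_range_succ',
        Finset.sum_range_succ] at h
      rw [catalan_succ', Finset.Nat.sum_antidiagonal_eq_sum_range_succ_mk]
      simp only [treesOf, Finset.card_empty, Nat.cast_zero, Nat.sub_self, zero_mul, mul_zero,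
        add_zero] at h
      rw [if_neg (by omega), zero_add] at h
      rw [← treesOf] at h
      have hcast : ((treesOf (n + 2)).card : ℝ) =
          ((∑ k ∈ Finset.range (n + 1), catalan k * catalan (n - k) : ℕ) : ℝ) := by
        rw [h, Nat.cast_sum]
        refine Finset.sum_congr rfl fun k hk => ?_
        have hk := Finset.mem_range.mp hk
        rw [show n + 2 - (k + 1) = (n - k) + 1 by omega, ih k (by omega), ih (n - k) (by omega), Nat.cast_mul]
      exact_mod_cast hcast

/-- The number of trees of magnitude `n` with `m` branches of order `2`. -/
noncomputable def branchCount (n m : ℕ) : ℝ :=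
  ∑ τ ∈ treesOf n, if branches 2 τ = m then 1 else 0

/-- The generating function, by magnitude, of the trees with `m` branches of order `2`. -/
noncomputable def branchSeries (m : ℕ) : PowerSeries ℝ :=
  PowerSeries.mk fun n => branchCount n m

theorem leaf_mem_treesOf_iff (n : ℕ) : leaf ∈ treesOf n ↔ n = 1 := by
  constructor
  · intro h
    simpa [magnitude] using (magnitude_of_mem_treesOf h).symm
  · rintro rfl
    simp [treesOf]

theorem branchSeries_zero : branchSeries 0 = PowerSeries.X := by
  ext n
  simp only [branchSeries, branchCount, branches_two_eq_zero_iff, PowerSeries.coeff_mk,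
    PowerSeries.coeff_X, Finset.sum_ite_eq', leaf_mem_treesOf_iff]

theorem sum_ite_leaf (i j : ℕ) :
    (∑ l ∈ treesOf i, ∑ r ∈ treesOf j, if l = leaf ∧ r = leaf then (1 : ℝ) else 0) =
      if i = 1 ∧ j = 1 then 1 else 0 := by
  simp only [ite_and, ← leaf_mem_treesOf_iff]
  rw [← Finset.sum_ite_eq' (treesOf i) leaf fun _ => if leaf ∈ treesOf j then (1 : ℝ) else 0]
  refine Finset.sum_congr rfl fun l _ => ?_
  split_ifs <;> simp_all

theorem sum_antidiagonal_ite (a b m : ℕ) :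
    (∑ q ∈ antidiagonal m, (if a = q.1 then (1 : ℝ) else 0) * if b = q.2 then 1 else 0) =
      if a + b = m then 1 else 0 := by
  simp_rw [← Finset.HasAntidiagonal.mem_antidiagonal (a := (a, b)),
    ← Finset.sum_ite_eq (antidiagonal m) (a, b) fun _ => (1 : ℝ)]
  refine Finset.sum_congr rfl fun q _ => ?_
  simp only [Prod.ext_iff, ite_and, ite_mul, one_mul, zero_mul]

theorem indicator_branches_node (l r : BinTree) (m : ℕ) :
    (if branches 2 (node l r) = m + 1 then (1 : ℝ) else 0) =
      (∑ q ∈ antidiagonal (m + 1), (if branches 2 l = q.1 then (1 : ℝ) else 0) *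
        if branches 2 r = q.2 then 1 else 0) +
      if m = 0 then (if l = leaf ∧ r = leaf then 1 else 0) else 0 := by
  rw [sum_antidiagonal_ite, branches_two_node]
  by_cases h : l = leaf ∧ r = leaf
  · obtain ⟨rfl, rfl⟩ := h
    simp [branches, eq_comm]
  · simp [h]

theorem coeff_mul_branchSeries (n a b : ℕ) :
    PowerSeries.coeff n (branchSeries a * branchSeries b) =
      ∑ p ∈ antidiagonal n, ∑ l ∈ treesOf p.1, ∑ r ∈ treesOf p.2,
        (if branches 2 l = a then (1 : ℝ) else 0) * if branches 2 r = b then 1 else 0 := by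
  simp only [PowerSeries.coeff_mul, branchSeries, PowerSeries.coeff_mk, branchCount,
    Finset.sum_mul_sum]

theorem branchSeries_succ (m : ℕ) :
    branchSeries (m + 1) =
      (∑ q ∈ antidiagonal (m + 1), branchSeries q.1 * branchSeries q.2) +
        if m = 0 then PowerSeries.X ^ 2 else 0 := by
  ext n
  rw [map_add, map_sum]
  simp only [coeff_mul_branchSeries]
  rw [branchSeries, PowerSeries.coeff_mk, branchCount, sum_treesOf]
  have h0 : (if n = 1 then (if branches 2 leaf = m + 1 then (1 : ℝ) else 0) else 0) = 0 := by
    simp [branches]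
  rw [h0, zero_add]
  simp only [indicator_branches_node, Finset.sum_add_distrib]
  congr 1
  · symm
    rw [Finset.sum_comm]
    refine Finset.sum_congr rfl fun p _ => ?_
    rw [Finset.sum_comm]
    refine Finset.sum_congr rfl fun l _ => ?_
    rw [Finset.sum_comm]
  · by_cases hm : m = 0
    · simp only [hm, if_true, sum_ite_leaf, PowerSeries.coeff_X_pow]
      have h : ∀ p : ℕ × ℕ, (p.1 = 1 ∧ p.2 = 1) ↔ p = (1, 1) := fun p => by
        rw [Prod.ext_iff]
      simp_rw [h]
      rw [Finset.sum_ite_eq' (antidiagonal n) (1, 1) fun _ => (1 : ℝ)]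
      simp only [Finset.HasAntidiagonal.mem_antidiagonal]
      simp [eq_comm]
    · simp [hm]

/-- The power series `(1 - 2X)⁻¹`. -/
noncomputable def geomTwo : PowerSeries ℝ :=
  PowerSeries.rescale 2 (PowerSeries.mk 1)

theorem geomTwo_eq : geomTwo = 1 + 2 * PowerSeries.X * geomTwo := by
  have h := congrArg (PowerSeries.rescale (2 : ℝ)) (PowerSeries.mk_one_mul_one_sub_eq_one ℝ)
  rw [map_mul, map_sub, map_one, PowerSeries.rescale_X] at h
  change geomTwo * _ = 1 at h
  have h2 : (PowerSeries.C (2 : ℝ)) = 2 := map_ofNat _ 2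
  rw [h2] at h
  linear_combination h

theorem coeff_geomTwo_pow (d t : ℕ) :
    PowerSeries.coeff t (geomTwo ^ (d + 1)) = 2 ^ t * ((d + t).choose d : ℝ) := by
  rw [geomTwo, ← map_pow, PowerSeries.mk_one_pow_eq_mk_choose_add, PowerSeries.coeff_rescale,
    PowerSeries.coeff_mk]

theorem eq_mul_geomTwo {A B : PowerSeries ℝ} (h : B = 2 * PowerSeries.X * B + A) :
    B = A * geomTwo := by
  linear_combination (-B) * geomTwo_eq + geomTwo * h

theorem branchSeries_eq (m : ℕ) :
    branchSeries (m + 1) =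
      (catalan m : PowerSeries ℝ) * PowerSeries.X ^ (2 * m + 2) * geomTwo ^ (2 * m + 1) := by
  induction m using Nat.strong_induction_on with
  | _ m ih =>
    match m with
    | 0 =>
      rw [eq_mul_geomTwo (B := branchSeries (0 + 1)) (A := PowerSeries.X ^ 2)]
      · simp
      · have h := branchSeries_succ 0
        simp only [zero_add, Finset.Nat.antidiagonal_succ, Finset.Nat.antidiagonal_zero,
          Finset.map_singleton, Finset.sum_cons, Finset.sum_singleton, if_true] at h ⊢
        simp [branchSeries_zero] at h
        linear_combination h
    | m + 1 =>
      have hsum : ∑ q ∈ antidiagonal m, branchSeries (q.1 + 1) * branchSeries (q.2 + 1) =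
          (catalan (m + 1) : PowerSeries ℝ) * PowerSeries.X ^ (2 * m + 4) *
            geomTwo ^ (2 * m + 2) := by
        rw [catalan_succ', Nat.cast_sum, Finset.sum_mul, Finset.sum_mul]
        refine Finset.sum_congr rfl fun q hq => ?_
        have hq := Finset.HasAntidiagonal.mem_antidiagonal.mp hq
        rw [ih q.1 (by omega) , ih q.2 (by omega) , ← hq]
        push_cast
        ring
      have h := branchSeries_succ (m + 1)
      rw [Finset.Nat.antidiagonal_succ_succ', Finset.sum_cons, Finset.sum_cons, Finset.sum_map]
        at h
      simp only [Function.Embedding.prodMap, Function.Embedding.coeFn_mk, Prod.map,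
        Nat.succ_eq_add_one, hsum, branchSeries_zero] at h
      rw [if_neg (by omega)] at h
      rw [eq_mul_geomTwo (B := branchSeries (m + 1 + 1)) (A := (catalan (m + 1) : PowerSeries ℝ) *
        PowerSeries.X ^ (2 * m + 4) * geomTwo ^ (2 * m + 2))]
      · ring
      · linear_combination h

theorem branchCount_eq (m t : ℕ) :
    branchCount (t + (2 * m + 2)) (m + 1) =
      (catalan m : ℝ) * (2 ^ t * ((2 * m + t).choose (2 * m) : ℝ)) := by
  have h := congrArg (PowerSeries.coeff (t + (2 * m + 2))) (branchSeries_eq m)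
  rw [branchSeries, PowerSeries.coeff_mk] at h
  rw [h, mul_assoc, ← map_natCast (PowerSeries.C (R := ℝ)), PowerSeries.coeff_C_mul,
    PowerSeries.coeff_X_pow_mul, coeff_geomTwo_pow]

theorem branchCount_eq_zero {n m : ℕ} (h : n < 2 * m + 2) : branchCount n (m + 1) = 0 := by
  have h' := congrArg (PowerSeries.coeff n) (branchSeries_eq m)
  rw [branchSeries, PowerSeries.coeff_mk] at h'
  rw [h', mul_assoc, ← map_natCast (PowerSeries.C (R := ℝ)), PowerSeries.coeff_C_mul,
    PowerSeries.coeff_X_pow_mul', if_neg (by omega), mul_zero]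

theorem branchCount_zero {n : ℕ} (h : 2 ≤ n) : branchCount n 0 = 0 := by
  have h' := congrArg (PowerSeries.coeff n) branchSeries_zero
  rw [branchSeries, PowerSeries.coeff_mk, PowerSeries.coeff_X, if_neg (by omega)] at h'
  exact h'

theorem add_two_mul_catalan_succ (m : ℕ) :
    ((m : ℝ) + 2) * catalan (m + 1) = 2 * (2 * m + 1) * catalan m := by
  have h1 := succ_mul_catalan_eq_centralBinom m
  have h2 := succ_mul_catalan_eq_centralBinom (m + 1)
  have h3 := Nat.succ_mul_centralBinom_succ m
  rw [← h1, ← h2] at h3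
  have h4 : ((m : ℝ) + 1) * (((m : ℝ) + 1 + 1) * catalan (m + 1)) =
      2 * (2 * m + 1) * ((m + 1) * catalan m) := by exact_mod_cast h3
  have h5 : ((m : ℝ) + 1) ≠ 0 := by positivity
  apply mul_left_cancel₀ h5
  linear_combination h4

theorem choose_add_two (n k : ℕ) :
    ((n + 2).choose (k + 2) : ℝ) * ((k + 2) * (k + 1)) = n.choose k * ((n + 2) * (n + 1)) := by
  have h1 : ((n : ℝ) + 1) * n.choose k = (n + 1).choose (k + 1) * (k + 1) := by
    exact_mod_cast Nat.add_one_mul_choose_eq n k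
  have h2 : ((n : ℝ) + 1 + 1) * (n + 1).choose (k + 1) =
      (n + 2).choose (k + 2) * (k + 1 + 1) := by
    exact_mod_cast Nat.add_one_mul_choose_eq (n + 1) (k + 1)
  linear_combination (-(k : ℝ) - 1) * h2 - ((n : ℝ) + 2) * h1

theorem branchCount_recurrence (n m : ℕ) :
    branchCount (n + 2) (m + 2) * ((m + 1) * (m + 2)) =
      branchCount n (m + 1) * (n * (n - 1)) := by
  rcases lt_or_ge n (2 * m + 2) with h | h
  · rw [branchCount_eq_zero h, branchCount_eq_zero (by omega), zero_mul, zero_mul]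
  · obtain ⟨t, rfl⟩ := Nat.exists_eq_add_of_le' h
    have h1 := branchCount_eq (m + 1) t
    rw [show t + (2 * (m + 1) + 2) = t + (2 * m + 2) + 2 by ring] at h1
    rw [branchCount_eq m t, h1, show 2 * (m + 1) + t = 2 * m + t + 2 by ring,
      show 2 * (m + 1) = 2 * m + 2 by ring]
    have h2 := choose_add_two (2 * m + t) (2 * m)
    have h3 := add_two_mul_catalan_succ m
    push_cast at h2 ⊢
    have h4 : (2 * (m : ℝ) + 1) ≠ 0 := by positivity
    apply mul_left_cancel₀ h4
    linear_combination
      (2 * (m : ℝ) + 1) * (m + 1) * 2 ^ t * ((2 * m + t + 2).choose (2 * m + 2) : ℝ) * h3 +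
        (2 * (m : ℝ) + 1) * catalan m * 2 ^ t * h2

theorem sum_branches_eq {n L : ℕ} (hL : ∀ τ ∈ treesOf n, branches 2 τ < L) (g : ℕ → ℝ) :
    ∑ τ ∈ treesOf n, g (branches 2 τ) = ∑ m ∈ Finset.range L, branchCount n m * g m := by
  simp only [branchCount, Finset.sum_mul]
  rw [Finset.sum_comm]
  refine Finset.sum_congr rfl fun τ hτ => ?_
  simp only [ite_mul, one_mul, zero_mul]
  rw [Finset.sum_ite_eq, if_pos (Finset.mem_range.mpr (hL τ hτ))]

/-- Exact relation between weighted sums over trees of magnitudes `n + 2` and `n`. -/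
theorem sum_branches_add_two {n : ℕ} (hn : 2 ≤ n) (F : ℕ → ℝ) :
    ∑ τ ∈ treesOf (n + 2),
        (branches 2 τ : ℝ) * ((branches 2 τ : ℝ) - 1) * F (branches 2 τ - 1) =
      n * (n - 1) * ∑ τ ∈ treesOf n, F (branches 2 τ) := by
  set L := (treesOf n).sup (branches 2) + (treesOf (n + 2)).sup (branches 2) + 1 with hLdef
  have h1 : ∀ τ ∈ treesOf n, branches 2 τ < L := fun τ hτ => by
    have := Finset.le_sup (f := branches 2) hτ
    omega
  have h2 : ∀ τ ∈ treesOf (n + 2), branches 2 τ < L + 1 := fun τ hτ => by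
    have := Finset.le_sup (f := branches 2) hτ
    omega
  rw [sum_branches_eq h1, sum_branches_eq h2 fun s => (s : ℝ) * ((s : ℝ) - 1) * F (s - 1),
    Finset.sum_range_succ', Finset.mul_sum]
  simp only [Nat.cast_zero, zero_mul, mul_zero, add_zero, Nat.add_sub_cancel]
  refine Finset.sum_congr rfl fun m _ => ?_
  match m with
  | 0 => simp [branchCount_zero hn]
  | m + 1 =>
    have h := branchCount_recurrence n m
    push_cast
    linear_combination F (m + 1) * h

theorem one_add_pow_le (K : ℕ) {x : ℝ} (h0 : 0 ≤ x) (h1 : x ≤ 1) :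
    (1 + x) ^ K ≤ 1 + (2 ^ K - 1) * x := by
  induction K with
  | zero => simp
  | succ K ih =>
    have h2 : (1 : ℝ) ≤ 2 ^ K := one_le_pow₀ (by norm_num)
    calc (1 + x) ^ (K + 1) = (1 + x) ^ K * (1 + x) := pow_succ _ _
      _ ≤ (1 + (2 ^ K - 1) * x) * (1 + x) := by gcongr
      _ ≤ 1 + (2 ^ (K + 1) - 1) * x := by
        rw [pow_succ]
        nlinarith [mul_nonneg (sub_nonneg.mpr h2) (mul_nonneg h0 (sub_nonneg.mpr h1))]

theorem shifted_inv_pow_bounds (k : ℕ) {s : ℕ} (hs : 1 ≤ s) :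
    ((s : ℝ) ^ k)⁻¹ - ((s : ℝ) ^ (k + 1))⁻¹ ≤
        (s : ℝ) * ((s : ℝ) - 1) * (((s - 1 : ℕ) : ℝ) ^ (k + 2))⁻¹ ∧
      (s : ℝ) * ((s : ℝ) - 1) * (((s - 1 : ℕ) : ℝ) ^ (k + 2))⁻¹ ≤
        ((s : ℝ) ^ k)⁻¹ + 2 ^ (k + 2) * ((s : ℝ) ^ (k + 1))⁻¹ := by
  obtain ⟨m, rfl⟩ := Nat.exists_eq_add_of_le' hs
  rcases Nat.eq_zero_or_pos m with rfl | hm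
  · simp
    positivity
  · rw [Nat.add_sub_cancel]
    push_cast
    have hm1 : (1 : ℝ) ≤ m := by exact_mod_cast hm
    set x : ℝ := (m : ℝ)
    have hx0 : 0 < x := by linarith
    have e1 : (x + 1) * (x + 1 - 1) * (x ^ (k + 2))⁻¹ = (x + 1) / x ^ (k + 1) := by
      field_simp
      ring
    have e2 : ∀ C : ℝ, ((x + 1) ^ k)⁻¹ + C * ((x + 1) ^ (k + 1))⁻¹ =
        (x + 1 + C) / (x + 1) ^ (k + 1) := fun C => by
      field_simp
      ring
    have e3 := e2 (-1)
    rw [neg_one_mul, ← sub_eq_add_neg] at e3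
    rw [e1, e2, e3]
    constructor
    · refine div_le_div₀ (by positivity) (by linarith) (by positivity) ?_
      gcongr
      linarith
    · rw [div_le_div_iff₀ (by positivity) (by positivity)]
      have h := one_add_pow_le (k + 1) (x := 1 / x) (by positivity)
        (by rw [div_le_one hx0]; exact hm1)
      have h3 : (1 + 1 / x) ^ (k + 1) * x ^ (k + 1) = (x + 1) ^ (k + 1) := by
        rw [← mul_pow]; congr 1; field_simp
      have h2 : (0 : ℝ) < 2 ^ (k + 1) := by positivity
      have h4 : (x + 1) * (1 + (2 ^ (k + 1) - 1) * (1 / x)) ≤ x + 1 + 2 ^ (k + 2) := by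
        rw [show (x + 1) * (1 + (2 ^ (k + 1) - 1) * (1 / x)) =
          x + 1 + (2 ^ (k + 1) - 1) * (1 + 1 / x) by field_simp]
        have h5 : 1 / x ≤ 1 := by rw [div_le_one hx0]; exact hm1
        have h6 : (0 : ℝ) < 1 / x := by positivity
        rw [pow_succ 2 (k + 1)]
        nlinarith
      rw [← h3, ← mul_assoc]
      gcongr
      refine le_trans ?_ h4
      gcongr

theorem treesOf_card_pos {n : ℕ} (hn : 1 ≤ n) : (0 : ℝ) < (treesOf n).card := by
  obtain ⟨n, rfl⟩ := Nat.exists_eq_add_of_le' hn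
  rw [card_treesOf_succ]
  have h : 0 < catalan n := by
    have h1 := succ_mul_catalan_eq_centralBinom n
    have h2 := Nat.centralBinom_pos n
    exact Nat.pos_of_ne_zero fun h => by simp [h] at h1; omega
  exact_mod_cast h

theorem card_treesOf_add_two {n : ℕ} (hn : 1 ≤ n) :
    ((treesOf (n + 2)).card : ℝ) * ((n + 2) * (n + 1)) =
      4 * (2 * n + 1) * (2 * n - 1) * (treesOf n).card := by
  obtain ⟨n, rfl⟩ := Nat.exists_eq_add_of_le' hn
  rw [show n + 1 + 2 = (n + 2) + 1 by ring, card_treesOf_succ, card_treesOf_succ]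
  have h1 := add_two_mul_catalan_succ n
  have h2 := add_two_mul_catalan_succ (n + 1)
  push_cast at h2 ⊢
  linear_combination ((n : ℝ) + 2) * h2 + 2 * (2 * (n : ℝ) + 3) * h1

theorem one_le_branches_two {n : ℕ} (hn : 2 ≤ n) {τ : BinTree} (hτ : τ ∈ treesOf n) :
    1 ≤ branches 2 τ := by
  rw [Nat.one_le_iff_ne_zero, Ne, branches_two_eq_zero_iff]
  rintro rfl
  have := (leaf_mem_treesOf_iff n).mp hτ
  omega

theorem expect_mono {n : ℕ} {f g : BinTree → ℝ} (h : ∀ τ ∈ treesOf n, f τ ≤ g τ) :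
    expect n f ≤ expect n g :=
  div_le_div_of_nonneg_right (Finset.sum_le_sum h) (Nat.cast_nonneg _)

theorem expect_add (n : ℕ) (f g : BinTree → ℝ) :
    expect n (fun τ => f τ + g τ) = expect n f + expect n g := by
  simp only [expect, Finset.sum_add_distrib, add_div]

theorem expect_const_mul (n : ℕ) (c : ℝ) (f : BinTree → ℝ) :
    expect n (fun τ => c * f τ) = c * expect n f := by
  simp only [expect, ← Finset.mul_sum, mul_div_assoc]

theorem expect_const {n : ℕ} (hn : 1 ≤ n) (c : ℝ) : expect n (fun _ => c) = c := by
  have := (treesOf_card_pos hn).ne'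
  simp only [expect, Finset.sum_const, nsmul_eq_mul]
  field_simp

/-- The expectation of `S ^ (-k)`, where `S` is the number of branches of order `2`. -/
noncomputable def negMoment (k n : ℕ) : ℝ :=
  expect n fun τ => ((branches 2 τ : ℝ) ^ k)⁻¹

/-- The ratio of the weights relating magnitudes `n + 2` and `n`. -/
noncomputable def shiftRatio (n : ℕ) : ℝ :=
  4 * (2 * n + 1) * (2 * n - 1) / ((n + 2) * (n + 1) * (n * (n - 1)))

theorem negMoment_add_two {n : ℕ} (hn : 2 ≤ n) (k : ℕ) :
    negMoment (k + 2) n = shiftRatio n * expect (n + 2) fun τ =>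
      (branches 2 τ : ℝ) * ((branches 2 τ : ℝ) - 1) *
        (((branches 2 τ - 1 : ℕ) : ℝ) ^ (k + 2))⁻¹ := by
  have h := sum_branches_add_two hn fun s => ((s : ℝ) ^ (k + 2))⁻¹
  have h1 := (treesOf_card_pos (show 1 ≤ n by omega)).ne'
  have h2 := (treesOf_card_pos (show 1 ≤ n + 2 by omega)).ne'
  have h3 := card_treesOf_add_two (show 1 ≤ n by omega)
  have hn' : (2 : ℝ) ≤ n := by exact_mod_cast hn
  have hn0 : (n : ℝ) ≠ 0 := by linarith
  have hn1 : (n : ℝ) - 1 ≠ 0 := by linarith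
  have hn2 : (n : ℝ) + 2 ≠ 0 := by linarith
  have hn3 : (n : ℝ) + 1 ≠ 0 := by linarith
  simp only [negMoment, expect, shiftRatio]
  rw [h]
  generalize ∑ τ ∈ treesOf n, ((branches 2 τ : ℝ) ^ (k + 2))⁻¹ = s
  field_simp
  linear_combination s * h3

theorem shiftRatio_nonneg {n : ℕ} (hn : 2 ≤ n) : 0 ≤ shiftRatio n := by
  have hn' : (2 : ℝ) ≤ n := by exact_mod_cast hn
  have hn1 : 0 ≤ (n : ℝ) - 1 := by linarith
  have hn2 : 0 ≤ 2 * (n : ℝ) - 1 := by linarith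
  unfold shiftRatio
  positivity

theorem negMoment_add_two_le {n : ℕ} (hn : 2 ≤ n) (k : ℕ) :
    negMoment (k + 2) n ≤
      shiftRatio n * (negMoment k (n + 2) + 2 ^ (k + 2) * negMoment (k + 1) (n + 2)) := by
  rw [negMoment_add_two hn, negMoment, negMoment, ← expect_const_mul (n + 2) (2 ^ (k + 2)), ← expect_add]
  refine mul_le_mul_of_nonneg_left (expect_mono fun τ hτ => ?_) (shiftRatio_nonneg hn)
  exact (shifted_inv_pow_bounds k (one_le_branches_two (by omega) hτ)).2

theorem le_negMoment_add_two {n : ℕ} (hn : 2 ≤ n) (k : ℕ) :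
    shiftRatio n * (negMoment k (n + 2) - negMoment (k + 1) (n + 2)) ≤
      negMoment (k + 2) n := by
  rw [negMoment_add_two hn, sub_eq_add_neg, ← neg_one_mul, negMoment, negMoment,
    ← expect_const_mul (n + 2) (-1), ← expect_add]
  refine mul_le_mul_of_nonneg_left (expect_mono fun τ hτ => ?_) (shiftRatio_nonneg hn)
  rw [neg_one_mul, ← sub_eq_add_neg]
  exact (shifted_inv_pow_bounds k (one_le_branches_two (by omega) hτ)).1

/-- The expectation of `(S / (n / 4)) ^ (-k)`, where `S` is the number of branches of
order `2`. -/
noncomputable def scaledMoment (k n : ℕ) : ℝ :=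
  expect n fun τ => ((n : ℝ) / 4 / branches 2 τ) ^ k

theorem scaledMoment_eq (k n : ℕ) : scaledMoment k n = ((n : ℝ) / 4) ^ k * negMoment k n := by
  simp only [scaledMoment, negMoment, ← expect_const_mul, div_pow _ (branches 2 _ : ℝ),
    div_eq_mul_inv _ ((branches 2 _ : ℝ) ^ k)]

theorem negMoment_eq {n : ℕ} (hn : 1 ≤ n) (k : ℕ) :
    negMoment k n = (4 / (n : ℝ)) ^ k * scaledMoment k n := by
  have h : (n : ℝ) ≠ 0 := by positivity
  rw [scaledMoment_eq, ← mul_assoc, ← mul_pow]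
  rw [show 4 / (n : ℝ) * (n / 4) = 1 by field_simp, one_pow, one_mul]

/-- The normalized version of `shiftRatio`. -/
noncomputable def scaledShiftRatio (k n : ℕ) : ℝ :=
  shiftRatio n * (((n : ℝ) / 4) ^ (k + 2) * (4 / ((n : ℝ) + 2)) ^ k)

theorem tendsto_scaledShiftRatio (k : ℕ) :
    Tendsto (fun n => scaledShiftRatio k n) atTop (𝓝 1) := by
  have hinv : Tendsto (fun n : ℕ => ((n : ℝ))⁻¹) atTop (𝓝 0) := tendsto_inv_atTop_nhds_zero_nat
  have h1 : Tendsto (fun n : ℕ =>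
      4 * (2 + (n : ℝ)⁻¹) * (2 - (n : ℝ)⁻¹) /
        ((1 + 2 * (n : ℝ)⁻¹) * (1 + (n : ℝ)⁻¹) * (1 - (n : ℝ)⁻¹)) / 16 *
          (1 / (1 + 2 * (n : ℝ)⁻¹)) ^ k) atTop
      (𝓝 (4 * (2 + 0) * (2 - 0) / ((1 + 2 * 0) * (1 + 0) * (1 - 0)) / 16 *
        (1 / (1 + 2 * 0)) ^ k)) := by
    have a := hinv.const_add (2 : ℝ)
    have b := hinv.const_sub (2 : ℝ)
    have c := (hinv.const_mul (2 : ℝ)).const_add (1 : ℝ)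
    have d := hinv.const_add (1 : ℝ)
    have e := hinv.const_sub (1 : ℝ)
    refine ((((a.const_mul 4).mul b).div ((c.mul d).mul e) (by norm_num)).div_const 16).mul
      ((tendsto_const_nhds.div c (by norm_num)).pow k)
  have h2 : (4 * (2 + 0) * (2 - 0) / ((1 + 2 * 0) * (1 + 0) * (1 - 0)) / 16 *
      (1 / (1 + 2 * 0)) ^ k : ℝ) = 1 := by norm_num
  rw [h2] at h1
  refine h1.congr' ?_
  filter_upwards [eventually_ge_atTop 2] with n hn
  have hn' : (2 : ℝ) ≤ n := by exact_mod_cast hn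
  have hn0 : (n : ℝ) ≠ 0 := by linarith
  have hn1 : (n : ℝ) - 1 ≠ 0 := by linarith
  have hn2 : (n : ℝ) + 2 ≠ 0 := by linarith
  have hn3 : (n : ℝ) + 1 ≠ 0 := by linarith
  have e1 : 1 / (1 + 2 * (n : ℝ)⁻¹) = n / 4 * (4 / (n + 2)) := by field_simp
  have e2 : 1 - (n : ℝ)⁻¹ = (n - 1) / n := by field_simp
  have e3 : 1 + (n : ℝ)⁻¹ = (n + 1) / n := by field_simp
  have e4 : 1 + 2 * (n : ℝ)⁻¹ = (n + 2) / n := by field_simp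
  rw [e1, e2, e3, e4, scaledShiftRatio, shiftRatio, pow_add, mul_pow]
  field_simp
  ring

theorem scaledShiftRatio_nonneg {n : ℕ} (hn : 2 ≤ n) (k : ℕ) : 0 ≤ scaledShiftRatio k n := by
  have := shiftRatio_nonneg hn
  unfold scaledShiftRatio
  positivity

theorem scaledMoment_add_two_aux {n : ℕ} (k : ℕ) (C : ℝ) :
    ((n : ℝ) / 4) ^ (k + 2) *
        (shiftRatio n * (negMoment k (n + 2) + C * negMoment (k + 1) (n + 2))) =
      scaledShiftRatio k n *
        (scaledMoment k (n + 2) + 4 * C * (scaledMoment (k + 1) (n + 2) / (n + 2 : ℕ))) := by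
  rw [negMoment_eq (by omega), negMoment_eq (by omega), scaledShiftRatio]
  push_cast
  ring

theorem scaledMoment_add_two_le {n : ℕ} (hn : 2 ≤ n) (k : ℕ) :
    scaledMoment (k + 2) n ≤ scaledShiftRatio k n *
      (scaledMoment k (n + 2) +
        4 * 2 ^ (k + 2) * (scaledMoment (k + 1) (n + 2) / (n + 2 : ℕ))) := by
  rw [scaledMoment_eq (k + 2), ← scaledMoment_add_two_aux]
  exact mul_le_mul_of_nonneg_left (negMoment_add_two_le hn k) (by positivity)

theorem le_scaledMoment_add_two {n : ℕ} (hn : 2 ≤ n) (k : ℕ) :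
    scaledShiftRatio k n *
      (scaledMoment k (n + 2) + 4 * (-1) * (scaledMoment (k + 1) (n + 2) / (n + 2 : ℕ))) ≤
        scaledMoment (k + 2) n := by
  rw [scaledMoment_eq (k + 2), ← scaledMoment_add_two_aux, neg_one_mul, ← sub_eq_add_neg]
  exact mul_le_mul_of_nonneg_left (le_negMoment_add_two hn k) (by positivity)

theorem scaledMoment_zero {n : ℕ} (hn : 1 ≤ n) : scaledMoment 0 n = 1 := by
  simp only [scaledMoment, pow_zero, expect_const hn]

theorem scaledMoment_nonneg (k n : ℕ) : 0 ≤ scaledMoment k n :=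
  div_nonneg (Finset.sum_nonneg fun _ _ => by positivity) (Nat.cast_nonneg _)

theorem scaledMoment_one_le {n : ℕ} (hn : 1 ≤ n) :
    scaledMoment 1 n ≤ (scaledMoment 2 n + 1) / 2 := by
  have h : scaledMoment 1 n ≤ expect n fun τ =>
      1 / 2 * ((n : ℝ) / 4 / branches 2 τ) ^ 2 + 1 / 2 := by
    refine expect_mono fun τ _ => ?_
    nlinarith [sq_nonneg ((n : ℝ) / 4 / branches 2 τ - 1)]
  rw [expect_add, expect_const_mul, expect_const hn] at h
  rw [scaledMoment] at h ⊢
  rw [scaledMoment]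
  linarith

theorem le_scaledMoment_one (n : ℕ) :
    2 * scaledMoment 2 n - scaledMoment 3 n ≤ scaledMoment 1 n := by
  have h : (expect n fun τ => 2 * ((n : ℝ) / 4 / branches 2 τ) ^ 2 +
      (-1) * ((n : ℝ) / 4 / branches 2 τ) ^ 3) ≤ scaledMoment 1 n := by
    refine expect_mono fun τ _ => ?_
    have hu : 0 ≤ (n : ℝ) / 4 / branches 2 τ := by positivity
    nlinarith [mul_nonneg hu (sq_nonneg ((n : ℝ) / 4 / branches 2 τ - 1))]
  rw [expect_add, expect_const_mul, expect_const_mul] at h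
  simp only [scaledMoment] at h ⊢
  linarith

theorem scaledMoment_one_le_self {n : ℕ} (hn : 2 ≤ n) : scaledMoment 1 n ≤ n := by
  refine (expect_mono (g := fun _ => (n : ℝ)) fun τ hτ => ?_).trans (expect_const (by omega) _).le
  have h : (1 : ℝ) ≤ branches 2 τ := by exact_mod_cast one_le_branches_two hn hτ
  have hn0 : (0 : ℝ) ≤ n := Nat.cast_nonneg n
  rw [pow_one]
  exact (div_le_self (by positivity) h).trans (by linarith)

theorem tendsto_scaledMoment_add_two {k : ℕ}
    (h0 : Tendsto (scaledMoment k) atTop (𝓝 1))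
    (h1 : Tendsto (fun n : ℕ => scaledMoment (k + 1) n / n) atTop (𝓝 0)) :
    Tendsto (scaledMoment (k + 2)) atTop (𝓝 1) := by
  have key : ∀ C : ℝ, Tendsto (fun n : ℕ => scaledShiftRatio k n *
      (scaledMoment k (n + 2) + 4 * C * (scaledMoment (k + 1) (n + 2) / (n + 2 : ℕ))))
      atTop (𝓝 1) := fun C => by
    have h := (tendsto_scaledShiftRatio k).mul
      ((h0.comp (tendsto_add_atTop_nat 2)).add
        ((h1.comp (tendsto_add_atTop_nat 2)).const_mul (4 * C)))
    simpa using h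
  refine tendsto_of_tendsto_of_tendsto_of_le_of_le' (key (-1)) (key (2 ^ (k + 2))) ?_ ?_
  · filter_upwards [eventually_ge_atTop 2] with n hn using le_scaledMoment_add_two hn k
  · filter_upwards [eventually_ge_atTop 2] with n hn using scaledMoment_add_two_le hn k

theorem tendsto_scaledMoment_zero : Tendsto (scaledMoment 0) atTop (𝓝 1) := by
  refine tendsto_const_nhds.congr' ?_
  filter_upwards [eventually_ge_atTop 1] with n hn using (scaledMoment_zero hn).symm

theorem tendsto_scaledMoment_one_div :
    Tendsto (fun n : ℕ => scaledMoment 1 n / n) atTop (𝓝 0) := by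
  have h : Tendsto (fun n : ℕ => (scaledShiftRatio 0 n * 17 + 1) / 2 * (n : ℝ)⁻¹) atTop
      (𝓝 ((1 * 17 + 1) / 2 * 0)) :=
    ((((tendsto_scaledShiftRatio 0).mul_const 17).add_const 1).div_const 2).mul
      tendsto_inv_atTop_nhds_zero_nat
  rw [mul_zero] at h
  refine squeeze_zero' (Eventually.of_forall fun n =>
    div_nonneg (scaledMoment_nonneg 1 n) (Nat.cast_nonneg n)) ?_ h
  filter_upwards [eventually_ge_atTop 2] with n hn
  rw [div_eq_mul_inv]
  refine mul_le_mul_of_nonneg_right ((scaledMoment_one_le (by omega)).trans ?_) (by positivity)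
  have h2 := scaledMoment_add_two_le hn 0
  have h3 : scaledMoment (0 + 1) (n + 2) / (n + 2 : ℕ) ≤ 1 :=
    div_le_one_of_le₀ (scaledMoment_one_le_self (by omega)) (Nat.cast_nonneg _)
  have h4 : scaledMoment 0 (n + 2) + 4 * 2 ^ (0 + 2) *
      (scaledMoment (0 + 1) (n + 2) / (n + 2 : ℕ)) ≤ 17 := by
    rw [scaledMoment_zero (by omega)]
    linarith
  have h5 := mul_le_mul_of_nonneg_left h4 (scaledShiftRatio_nonneg hn 0)
  have h6 := h2.trans h5
  rw [zero_add] at h6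
  gcongr

theorem tendsto_scaledMoment_two : Tendsto (scaledMoment 2) atTop (𝓝 1) :=
  tendsto_scaledMoment_add_two tendsto_scaledMoment_zero tendsto_scaledMoment_one_div

theorem Filter.Tendsto.div_natCast {f : ℕ → ℝ} {a : ℝ} (h : Tendsto f atTop (𝓝 a)) :
    Tendsto (fun n : ℕ => f n / n) atTop (𝓝 0) := by
  simpa [div_eq_mul_inv] using h.mul (tendsto_inv_atTop_nhds_zero_nat (𝕜 := ℝ))

theorem tendsto_scaledMoment_one : Tendsto (scaledMoment 1) atTop (𝓝 1) := by
  have h2 := tendsto_scaledMoment_two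
  have hu : Tendsto (fun n => (scaledMoment 2 n + 1) / 2) atTop (𝓝 1) := by
    have h := (h2.add_const 1).div_const 2
    norm_num at h
    exact h
  have h3 : Tendsto (fun n : ℕ => scaledShiftRatio 1 n * ((scaledMoment 2 (n + 2) + 1) / 2 +
      4 * 2 ^ (1 + 2) * (scaledMoment (1 + 1) (n + 2) / (n + 2 : ℕ)))) atTop (𝓝 1) := by
    have h := (tendsto_scaledShiftRatio 1).mul ((hu.comp (tendsto_add_atTop_nat 2)).add
      ((h2.div_natCast.comp (tendsto_add_atTop_nat 2)).const_mul (4 * 2 ^ (1 + 2))))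
    simpa using h
  have hl := (h2.const_mul 2).sub h3
  rw [show (2 * 1 - 1 : ℝ) = 1 by norm_num] at hl
  refine tendsto_of_tendsto_of_tendsto_of_le_of_le' hl hu ?_ ?_
  · filter_upwards [eventually_ge_atTop 2] with n hn
    refine le_trans (sub_le_sub_left ?_ _) (le_scaledMoment_one n)
    refine (scaledMoment_add_two_le hn 1).trans
      (mul_le_mul_of_nonneg_left ?_ (scaledShiftRatio_nonneg hn 1))
    exact add_le_add_left (scaledMoment_one_le (by omega)) _
  · filter_upwards [eventually_ge_atTop 1] with n hn using scaledMoment_one_le hn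

theorem tendsto_scaledMoment (k : ℕ) : Tendsto (scaledMoment k) atTop (𝓝 1) := by
  suffices h : Tendsto (scaledMoment k) atTop (𝓝 1) ∧
      Tendsto (scaledMoment (k + 1)) atTop (𝓝 1) from h.1
  induction k with
  | zero => exact ⟨tendsto_scaledMoment_zero, tendsto_scaledMoment_one⟩
  | succ k ih => exact ⟨ih.2, tendsto_scaledMoment_add_two ih.1 ih.2.div_natCast⟩

/-- Negative moments of `S_{2,n}` (Proposition 2): for fixed `k ≥ 0`,
`⟨S_{2,n}^{−k}⟩ ∼ (n/4)^{−k}`. -/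
theorem negative_moments_S2 (k : ℕ) :
    Tendsto (fun n : ℕ =>
        expect n (fun τ => ((BinTree.branches 2 τ : ℝ)) ^ (-(k : ℤ)))
          / ((n : ℝ) / 4) ^ (-(k : ℤ)))
      atTop (𝓝 1) := by
  refine (tendsto_scaledMoment k).congr fun n => ?_
  simp only [scaledMoment_eq, negMoment, zpow_neg, zpow_natCast, div_inv_eq_mul, mul_comm]
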